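/- Let ‖·‖ be any sub-multiplicative norm on matrices, and let A_1, …, A_k and Â_1, …, Â_k be matrices of compatible dimensions so that the products A_1⋯A_k and Â_1⋯Â_k are defined. If ‖A_i‖ > 0 and ‖Â_i − A_i‖ ≤ ‖A_i‖ for every i, then ‖Â_1⋯Â_k − A_1⋯A_k‖ ≤ 2^{k−1} (∏_{i=1}^k ‖A_i‖) · Σ_{i=1}^k ‖Â_i − A_i‖ / ‖A_i‖. -/

import Mathlib

open Matrix Finset

section Submultiplicative

variable {R : Type*} [Ring R] {N : R → ℝ}

/-- A sub-multiplicative function is bounded on nonempty products by the product of its values.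
The product must be nonempty because nothing is known about `N 1`. -/
lemma apply_prod_ofFn_succ_le (hN0 : ∀ a, 0 ≤ N a) (hNmul : ∀ a b, N (a * b) ≤ N a * N b)
    {k : ℕ} (a : Fin (k + 1) → R) : N (List.ofFn a).prod ≤ ∏ i, N (a i) := by
  induction k with
  | zero => simp
  | succ k ih =>
    rw [List.ofFn_succ, List.prod_cons, Fin.prod_univ_succ]
    exact (hNmul _ _).trans (mul_le_mul_of_nonneg_left (ih _) (hN0 _))

/-- If each factor `b i` is within `N (a i)` of `a i`, then a nonempty product of the `b i` is at
most `2 ^ (k + 1) * ∏ i, N (a i)`. -/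
lemma apply_prod_ofFn_succ_le_two_pow_mul (hN0 : ∀ a, 0 ≤ N a)
    (hNadd : ∀ a b, N (a + b) ≤ N a + N b) (hNmul : ∀ a b, N (a * b) ≤ N a * N b)
    {k : ℕ} (a b : Fin (k + 1) → R) (hclose : ∀ i, N (b i - a i) ≤ N (a i)) :
    N (List.ofFn b).prod ≤ 2 ^ (k + 1) * ∏ i, N (a i) := by
  have hb (i) : N (b i) ≤ 2 * N (a i) := by
    have h := hNadd (b i - a i) (a i)
    rw [sub_add_cancel] at h
    linarith [hclose i]
  calc N (List.ofFn b).prod ≤ ∏ i, N (b i) := apply_prod_ofFn_succ_le hN0 hNmul b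
    _ ≤ ∏ i, 2 * N (a i) := prod_le_prod (fun i _ => hN0 _) fun i _ => hb i
    _ = 2 ^ (k + 1) * ∏ i, N (a i) := by simp [prod_mul_distrib]

lemma apply_prod_ofFn_succ_sub_le (hN0 : ∀ a, 0 ≤ N a)
    (hNadd : ∀ a b, N (a + b) ≤ N a + N b) (hNmul : ∀ a b, N (a * b) ≤ N a * N b)
    {k : ℕ} (a b : Fin (k + 1) → R) (hpos : ∀ i, 0 < N (a i))
    (hclose : ∀ i, N (b i - a i) ≤ N (a i)) :
    N ((List.ofFn b).prod - (List.ofFn a).prod) ≤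
      2 ^ k * (∏ i, N (a i)) * ∑ i, N (b i - a i) / N (a i) := by
  induction k with
  | zero => simp [mul_div_cancel₀ _ (hpos 0).ne']
  | succ k ih =>
    rw [List.ofFn_succ (f := b), List.ofFn_succ (f := a), List.prod_cons, List.prod_cons,
      Fin.prod_univ_succ, Fin.sum_univ_succ]
    have hdiff := ih (fun i => a i.succ) (fun i => b i.succ) (fun i => hpos _) fun i => hclose _
    have htail := apply_prod_ofFn_succ_le_two_pow_mul hN0 hNadd hNmul (fun i => a i.succ)
      (fun i => b i.succ) fun i => hclose _
    set p := (List.ofFn fun i : Fin (k + 1) => a i.succ).prod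
    set q := (List.ofFn fun i : Fin (k + 1) => b i.succ).prod
    set P := ∏ i : Fin (k + 1), N (a i.succ)
    set S := ∑ i : Fin (k + 1), N (b i.succ - a i.succ) / N (a i.succ)
    have hP : 0 ≤ P := prod_nonneg fun i _ => hN0 _
    have hS : 0 ≤ S := sum_nonneg fun i _ => div_nonneg (hN0 _) (hN0 _)
    have ha := hpos 0
    calc N (b 0 * q - a 0 * p) = N ((b 0 - a 0) * q + a 0 * (q - p)) := by congr 1; noncomm_ring
      _ ≤ N (b 0 - a 0) * N q + N (a 0) * N (q - p) :=
        (hNadd _ _).trans (add_le_add (hNmul _ _) (hNmul _ _))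
      _ ≤ N (b 0 - a 0) * (2 ^ (k + 1) * P) + N (a 0) * (2 ^ k * P * S) :=
        add_le_add (mul_le_mul_of_nonneg_left htail (hN0 _))
          (mul_le_mul_of_nonneg_left hdiff (hN0 _))
      _ ≤ N (b 0 - a 0) * (2 ^ (k + 1) * P) + N (a 0) * (2 ^ (k + 1) * P * S) := by
        gcongr <;> norm_num
      _ = 2 ^ (k + 1) * (N (a 0) * P) * (N (b 0 - a 0) / N (a 0) + S) := by
        field_simp

end Submultiplicative

/-- For a sub-multiplicative matrix norm `N` (nonnegative, satisfying the triangle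
inequality, invariant under negation, and sub-multiplicative), and matrices
`A 0, …, A (k-1)` together with perturbed versions `Ah i` with
`N (Ah i - A i) ≤ N (A i)`, the perturbation of the product satisfies
`N (Ah 0 ⋯ Ah (k-1) - A 0 ⋯ A (k-1)) ≤ 2^{k-1} (∏ i, N (A i)) ∑ i, N (Ah i - A i) / N (A i)`. -/
theorem product_perturbation_bound
    {n k : ℕ} (hk : 1 ≤ k)
    (N : Matrix (Fin n) (Fin n) ℝ → ℝ)
    (hN0 : ∀ A, 0 ≤ N A)
    (hNadd : ∀ A B, N (A + B) ≤ N A + N B)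
    (hNneg : ∀ A, N (-A) = N A)
    (hNmul : ∀ A B, N (A * B) ≤ N A * N B)
    (A Ah : Fin k → Matrix (Fin n) (Fin n) ℝ)
    (hpos : ∀ i, 0 < N (A i))
    (hclose : ∀ i, N (Ah i - A i) ≤ N (A i)) :
    N ((List.ofFn Ah).prod - (List.ofFn A).prod) ≤
      2 ^ (k - 1) * (∏ i, N (A i)) * ∑ i, N (Ah i - A i) / N (A i) := by
  obtain ⟨k, rfl⟩ := Nat.exists_eq_add_of_le' hk
  exact apply_prod_ofFn_succ_sub_le hN0 hNadd hNmul A Ah hpos hclose
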